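/- arXiv:1909.12833 — 8 statements merged into one kernel-verified Lean document; each statement's English description precedes it below -/
import Mathlib

section
/- Let P be a finite poset whose set of cover relations C is partitioned as C = G ⊔ B, and assume this partition is acyclic. Then the sum of (−1)^{|𝓘|} over all G-sequences 𝓘 of P equals (−1)^{|P|} if G = ∅, and equals 0 if G ≠ ∅. -/
open scoped Classical

/-- A `G`-sequence for a partition `C = G ⊔ B` of the cover relations of a finite
poset `P`: an increasing sequence `∅ = I₀ ⊊ I₁ ⊊ ⋯ ⊊ I_ℓ = P` of order ideals such
that every cover relation between two elements of some difference `I_i \ I_{i-1}`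
lies in `G`. -/
def IsGSeq {P : Type*} [Fintype P] [PartialOrder P] (G : Set (P × P))
    (ℓ : ℕ) (I : Fin (ℓ + 1) → Finset P) : Prop :=
  I 0 = ∅ ∧ I (Fin.last ℓ) = Finset.univ ∧
    (∀ i : Fin ℓ, I i.castSucc ⊂ I i.succ) ∧
    (∀ i : Fin (ℓ + 1), IsLowerSet (↑(I i) : Set P)) ∧
    ∀ i : Fin ℓ, ∀ x ∈ I i.succ \ I i.castSucc, ∀ y ∈ I i.succ \ I i.castSucc,
      x ⋖ y → (x, y) ∈ G

/-- A chain of order ideals as in `IsGSeq`, but ending in an arbitrary ideal `J`. -/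
def IsGSeqTo {P : Type*} [PartialOrder P] (G : Set (P × P)) (J : Finset P)
    (ℓ : ℕ) (I : Fin (ℓ + 1) → Finset P) : Prop :=
  I 0 = ∅ ∧ I (Fin.last ℓ) = J ∧
    (∀ i : Fin ℓ, I i.castSucc ⊂ I i.succ) ∧
    (∀ i : Fin (ℓ + 1), IsLowerSet (↑(I i) : Set P)) ∧
    ∀ i : Fin ℓ, ∀ x ∈ I i.succ \ I i.castSucc, ∀ y ∈ I i.succ \ I i.castSucc,
      x ⋖ y → (x, y) ∈ G

section

variable {P : Type*} [PartialOrder P] {G B : Set (P × P)}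

/-- Every cover relation between two elements of `J \ K` lies in `G`. -/
def IsGStep (G : Set (P × P)) (K J : Finset P) : Prop :=
  ∀ x ∈ J \ K, ∀ y ∈ J \ K, x ⋖ y → (x, y) ∈ G

/-- No pair of elements of `J` lies in `G`. -/
def IsGFree (G : Set (P × P)) (J : Finset P) : Prop :=
  ∀ x ∈ J, ∀ y ∈ J, (x, y) ∉ G

theorem IsGSeqTo.le_card {J : Finset P} {ℓ : ℕ} {I : Fin (ℓ + 1) → Finset P}
    (h : IsGSeqTo G J ℓ I) : ℓ ≤ J.card := by
  have key : ∀ i : Fin (ℓ + 1), (i : ℕ) ≤ (I i).card := by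
    intro i
    induction i using Fin.induction with
    | zero => simp
    | succ i ih =>
      have := Finset.card_lt_card (h.2.2.1 i)
      simp only [Fin.val_succ, Fin.val_castSucc] at *
      omega
  simpa [h.2.1] using key (Fin.last ℓ)

theorem isGSeqTo_zero_iff {J : Finset P} {I : Fin 1 → Finset P} :
    IsGSeqTo G J 0 I ↔ I = (fun _ => ∅) ∧ J = ∅ := by
  constructor
  · rintro ⟨h0, h1, -⟩
    refine ⟨funext fun i => ?_, ?_⟩
    · rw [Subsingleton.elim i 0, h0]
    · rw [← h1, ← h0]; rfl
  · rintro ⟨rfl, rfl⟩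
    refine ⟨rfl, rfl, fun i => i.elim0, fun i => ?_, fun i => i.elim0⟩
    simp [isLowerSet_empty]

theorem isGSeqTo_snoc_iff {J K : Finset P} {ℓ : ℕ} {I : Fin (ℓ + 1) → Finset P} :
    IsGSeqTo G J (ℓ + 1) (Fin.snoc (α := fun _ => Finset P) I K) ↔
      K = J ∧ IsLowerSet (↑J : Set P) ∧ I (Fin.last ℓ) ⊂ J ∧
        IsGStep G (I (Fin.last ℓ)) J ∧ IsGSeqTo G (I (Fin.last ℓ)) ℓ I := by
  have h0 : (Fin.snoc (α := fun _ => Finset P) I K : Fin (ℓ + 1 + 1) → Finset P) 0 = I 0 := by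
    rw [← Fin.castSucc_zero, Fin.snoc_castSucc]
  unfold IsGSeqTo IsGStep
  rw [h0]
  simp only [Fin.forall_fin_succ' (n := ℓ), Fin.forall_fin_succ' (n := ℓ + 1),
    Fin.snoc_castSucc, Fin.snoc_last, Fin.succ_last, Fin.succ_castSucc]
  constructor
  · rintro ⟨h1, rfl, h3, h4, h5⟩
    exact ⟨rfl, h4.2, h3.2, h5.2, h1, trivial, h3.1, h4.1, h5.1⟩
  · rintro ⟨rfl, h2, h3, h4, h5, -, h6, h7, h8⟩
    exact ⟨h5, rfl, ⟨h6, h3⟩, ⟨h7, h2⟩, h8, h4⟩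

variable [Fintype P]

/-- The signed number of chains of length `ℓ` ending in `J`. -/
noncomputable def gSeqToCount (G : Set (P × P)) (ℓ : ℕ) (J : Finset P) : ℤ :=
  ∑ I : Fin (ℓ + 1) → Finset P, if IsGSeqTo G J ℓ I then (-1 : ℤ) ^ ℓ else 0

theorem gSeqToCount_zero (J : Finset P) :
    gSeqToCount G 0 J = if J = ∅ then 1 else 0 := by
  simp only [gSeqToCount, pow_zero, isGSeqTo_zero_iff]
  by_cases hJ : J = ∅
  · simp only [hJ, and_true, if_true]
    exact (Finset.sum_ite_eq' _ _ _).trans (by simp)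
  · simp [hJ]

theorem gSeqToCount_succ {J : Finset P} (hJ : IsLowerSet (↑J : Set P)) (ℓ : ℕ) :
    gSeqToCount G (ℓ + 1) J =
      -∑ K ∈ J.ssubsets.filter fun K : Finset P => IsLowerSet (↑K : Set P) ∧ IsGStep G K J,
        gSeqToCount G ℓ K := by
  unfold gSeqToCount
  rw [← (Fin.snocEquiv fun _ : Fin (ℓ + 2) => Finset P).sum_comp, Fintype.sum_prod_type_right]
  conv_rhs => rw [Finset.sum_comm, ← Finset.sum_neg_distrib]
  refine Finset.sum_congr rfl fun I _ => ?_
  simp only [Fin.snocEquiv, Equiv.coe_fn_mk, isGSeqTo_snoc_iff]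
  rw [Finset.sum_eq_single J (fun K _ hK => if_neg fun h => hK h.1) (by simp),
    Finset.sum_filter]
  have hlow : IsGSeqTo G (I (Fin.last ℓ)) ℓ I → IsLowerSet (↑(I (Fin.last ℓ)) : Set P) :=
    fun h => h.2.2.2.1 _
  have hne : ∀ K, K ≠ I (Fin.last ℓ) → ¬ IsGSeqTo G K ℓ I := fun K hK h => hK h.2.1.symm
  by_cases hss : I (Fin.last ℓ) ⊂ J
  · rw [Finset.sum_eq_single (I (Fin.last ℓ))]
    · split_ifs <;> simp_all [pow_succ]
    · intro K _ hK
      rw [if_neg (hne K hK), ite_self]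
    · exact fun h => absurd (Finset.mem_ssubsets.2 hss) h
  · rw [if_neg fun h => hss h.2.2.1, Finset.sum_eq_zero, neg_zero]
    intro K hK
    rw [if_neg (hne K _), ite_self]
    rintro rfl
    exact hss (Finset.mem_ssubsets.1 hK)

theorem sum_gFree_eq_zero {J : Finset P} (hJ : IsLowerSet (↑J : Set P)) (hne : J.Nonempty)
    (hG : ∀ p ∈ G, p.1 ⋖ p.2) (hcov : ∀ x y : P, x ⋖ y → (x, y) ∈ G ∪ B)
    (hacyc : ∀ x : P,
      ¬ Relation.TransGen (fun a b : P => (a, b) ∈ G ∨ (b, a) ∈ B) x x) :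
    ∑ K ∈ J.powerset.filter fun K : Finset P =>
        IsLowerSet (↑K : Set P) ∧ IsGStep G K J ∧ IsGFree G K,
      (-1 : ℤ) ^ K.card = 0 := by
  obtain ⟨m, hmJ, hm⟩ : ∃ m ∈ J, ∀ a ∈ J, ¬ ((a, m) ∈ G ∨ (m, a) ∈ B) := by
    let r := Relation.TransGen (fun a b : P => (a, b) ∈ G ∨ (b, a) ∈ B)
    have : IsTrans P r := ⟨fun _ _ _ => Relation.TransGen.trans⟩
    have : Std.Irrefl r := ⟨hacyc⟩
    obtain ⟨m, hm, h⟩ := (Finite.wellFounded_of_trans_of_irrefl r).has_min (J : Set P) hne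
    exact ⟨m, hm, fun a ha hr => h a ha (.single hr)⟩
  refine Finset.sum_involution (fun K _ => if m ∈ K then K.erase m else insert m K) ?_ ?_ ?_ ?_
  · intro K _
    split_ifs with h
    · rw [← Finset.card_erase_add_one h, pow_succ]; ring
    · rw [Finset.card_insert_of_notMem h, pow_succ]; ring
  · intro K _ _
    split_ifs with h
    · exact fun e => Finset.notMem_erase m K (e.ge h)
    · exact fun e => h (e.le (Finset.mem_insert_self m K))
  · intro K hK
    simp only [Finset.mem_filter, Finset.mem_powerset] at hK ⊢
    obtain ⟨hKJ, hlow, hstep, hfree⟩ := hK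
    split_ifs with h
    · refine ⟨(Finset.erase_subset _ _).trans hKJ, ?_, ?_, ?_⟩
      · intro y x hxy hy
        simp only [Finset.coe_erase, Set.mem_sdiff, Finset.mem_coe, Set.mem_singleton_iff] at hy ⊢
        refine ⟨hlow hxy hy.1, ?_⟩
        rintro rfl
        obtain ⟨c, hc, hcy⟩ := exists_covBy_le_of_lt (lt_of_le_of_ne hxy (Ne.symm hy.2))
        have hcK : c ∈ K := hlow hcy hy.1
        rcases hcov _ _ hc with h' | h'
        · exact hfree _ h _ hcK h'
        · exact hm c (hKJ hcK) (.inr h')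
      · intro x hx y hy hxy
        simp only [Finset.mem_sdiff, Finset.mem_erase, not_and_or, not_not] at hx hy
        rcases hcov _ _ hxy with h' | h'
        · exact h'
        rcases hx with ⟨hxJ, rfl | hxK⟩
        · exact (hm _ hy.1 (.inr h')).elim
        rcases hy with ⟨hyJ, rfl | hyK⟩
        · exact (hxK (hlow hxy.le h)).elim
        · exact hstep x (by simp [*]) y (by simp [*]) hxy
      · exact fun x hx y hy => hfree x (Finset.mem_of_mem_erase hx) y (Finset.mem_of_mem_erase hy)
    · refine ⟨Finset.insert_subset hmJ hKJ, ?_, ?_, ?_⟩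
      · intro y x hxy hy
        simp only [Finset.coe_insert, Set.mem_insert_iff, Finset.mem_coe] at hy ⊢
        rcases hy with rfl | hy
        · rcases hxy.eq_or_lt with rfl | hlt
          · exact .inl rfl
          obtain ⟨c, hxc, hc⟩ := exists_le_covBy_of_lt hlt
          have hcJ : c ∈ J := hJ hc.le hmJ
          refine .inr (hlow hxc ?_)
          by_contra hcK
          exact hm c hcJ (.inl (hstep c (by simp_all) y (by simp_all) hc))
        · exact .inr (hlow hxy hy)
      · intro x hx y hy
        simp only [Finset.mem_sdiff, Finset.mem_insert, not_or] at hx hy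
        exact hstep x (by simp [*]) y (by simp [*])
      · intro x hx y hy hxy
        rcases Finset.mem_insert.1 hy with rfl | hyK
        · rcases Finset.mem_insert.1 hx with rfl | hxK
          · exact hm _ hmJ (.inl hxy)
          · exact hm x (hKJ hxK) (.inl hxy)
        · rcases Finset.mem_insert.1 hx with rfl | hxK
          · exact h (hlow (hG _ hxy).le hyK)
          · exact hfree x hxK y hyK hxy
  · intro K _
    by_cases h : m ∈ K <;> simp [h]

theorem sum_gSeqToCount (hG : ∀ p ∈ G, p.1 ⋖ p.2) (hcov : ∀ x y : P, x ⋖ y → (x, y) ∈ G ∪ B)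
    (hacyc : ∀ x : P,
      ¬ Relation.TransGen (fun a b : P => (a, b) ∈ G ∨ (b, a) ∈ B) x x)
    (n : ℕ) {J : Finset P} (hJ : IsLowerSet (↑J : Set P)) (hn : J.card ≤ n) :
    ∑ ℓ ∈ Finset.range (n + 1), gSeqToCount G ℓ J =
      if IsGFree G J then (-1 : ℤ) ^ J.card else 0 := by
  induction n generalizing J with
  | zero =>
    obtain rfl : J = ∅ := by simpa using hn
    simp [gSeqToCount_zero, IsGFree]
  | succ n ih =>
    rw [Finset.sum_range_succ', gSeqToCount_zero]
    simp only [gSeqToCount_succ hJ, Finset.sum_neg_distrib]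
    rw [Finset.sum_comm]
    rcases J.eq_empty_or_nonempty with rfl | hne
    · have h : (∅ : Finset P).ssubsets = ∅ := rfl
      simp [IsGFree, h]
    have hs : ∀ K ∈ J.ssubsets.filter (fun K : Finset P => IsLowerSet (↑K : Set P) ∧ IsGStep G K J),
        ∑ ℓ ∈ Finset.range (n + 1), gSeqToCount G ℓ K =
          if IsGFree G K then (-1 : ℤ) ^ K.card else 0 := by
      intro K hK
      simp only [Finset.mem_filter, Finset.mem_ssubsets] at hK
      have := Finset.card_lt_card hK.1
      exact ih hK.2.1 (by omega)
    rw [Finset.sum_congr rfl hs, if_neg hne.ne_empty, add_zero, ← Finset.sum_filter,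
      Finset.filter_filter]
    have h0 := sum_gFree_eq_zero hJ hne hG hcov hacyc
    have hp : J.powerset = insert J J.ssubsets := by
      simp [Finset.ssubsets, Finset.insert_erase]
    have hself : IsGStep G J J := fun x hx => by simp at hx
    simp only [hp, Finset.filter_insert, hJ, hself, true_and] at h0
    simp only [and_assoc]
    split_ifs at h0 ⊢ with hf
    · rw [Finset.sum_insert (by simp)] at h0
      linarith
    · rw [h0, neg_zero]

end

/-- Lemma 3.17: for an acyclic partition `C = G ⊔ B` of the cover relations of a
finite poset `P`, the signed count of `G`-sequences is `(-1)^{|P|}` if `G = ∅`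
and `0` otherwise. -/
theorem gseq_signed_count {P : Type*} [Fintype P] [PartialOrder P]
    (G B : Set (P × P))
    (hG : ∀ p ∈ G, p.1 ⋖ p.2) (hB : ∀ p ∈ B, p.1 ⋖ p.2)
    (hdisj : Disjoint G B)
    (hcov : ∀ x y : P, x ⋖ y → (x, y) ∈ G ∪ B)
    (hacyc : ∀ x : P,
      ¬ Relation.TransGen (fun a b : P => (a, b) ∈ G ∨ (b, a) ∈ B) x x) :
    (∑ᶠ ℓ : ℕ, ∑ᶠ I : Fin (ℓ + 1) → Finset P,
        if IsGSeq G ℓ I then (-1 : ℤ) ^ ℓ else 0) =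
      if G = ∅ then (-1 : ℤ) ^ Fintype.card P else 0 := by
  have hfree : IsGFree G (Finset.univ : Finset P) ↔ G = ∅ := by
    simp [IsGFree, Set.eq_empty_iff_forall_notMem]
  have hsum : ∀ ℓ : ℕ, (∑ᶠ I : Fin (ℓ + 1) → Finset P,
      if IsGSeq G ℓ I then (-1 : ℤ) ^ ℓ else 0) = gSeqToCount G ℓ Finset.univ :=
    fun ℓ => finsum_eq_sum_of_fintype _
  simp only [hsum]
  rw [finsum_eq_sum_of_support_subset (s := Finset.range (Fintype.card P + 1)),
    sum_gSeqToCount hG hcov hacyc (Fintype.card P) (J := Finset.univ)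
      (by simpa using isLowerSet_univ) le_rfl]
  · simp only [hfree, Finset.card_univ]
  · intro ℓ hℓ
    obtain ⟨I, -, hI⟩ := Finset.exists_ne_zero_of_sum_ne_zero hℓ
    have := (of_not_not fun h => hI (if_neg h) : IsGSeqTo G Finset.univ ℓ I).le_card
    simpa [Nat.lt_succ_iff] using this
end

section
/- Let P be a finite poset whose set of cover relations C is partitioned as C = G ⊔ B, and assume this partition is acyclic. Define Y, X, Y′ and 𝒜 as below. Then: (1) if X = ∅, then 𝒜 is exactly the collection of nonempty subsets of the set of minimal elements of P; (2) if X ≠ ∅ and some cover relation between two elements of X lies in B, then 𝒜 = ∅; (3) if X ≠ ∅ and every cover relation between two elements of X lies in G, then 𝒜 = { X ∪ I : I ⊆ Y′ }. -/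
open scoped Classical

/-- Claim 3.21: description of the set `𝒜` of nonempty order ideals `A` of `P`
all of whose internal covers are good and all covers internal to the complement
are bad, in terms of the maximal "bad-at-the-top" upper set `Y`, its complement
`X`, and the set `Y′` of minimal elements of `Y` all of whose lower covers are good. -/
theorem claim_ideals_description {P : Type*} [Fintype P] [PartialOrder P]
    (G B : Set (P × P))
    (hG : ∀ p ∈ G, p.1 ⋖ p.2) (hB : ∀ p ∈ B, p.1 ⋖ p.2)
    (hdisj : Disjoint G B)
    (hcov : ∀ x y : P, x ⋖ y → (x, y) ∈ G ∪ B)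
    (hacyc : ∀ x : P,
      ¬ Relation.TransGen (fun a b : P => (a, b) ∈ G ∨ (b, a) ∈ B) x x)
    (Y : Set P)
    (hY : Y = ⋃₀ {S : Set P | IsUpperSet S ∧ ∀ x ∈ S, ∀ y ∈ S, x ⋖ y → (x, y) ∈ B})
    (X : Set P) (hX : X = Yᶜ)
    (Y' : Set P)
    (hY' : Y' = {y | Minimal (· ∈ Y) y ∧ ∀ x : P, x ⋖ y → (x, y) ∈ G})
    (𝒜 : Set (Set P))
    (h𝒜 : 𝒜 = {A : Set P | A.Nonempty ∧ IsLowerSet A ∧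
        (∀ x ∈ A, ∀ y ∈ A, x ⋖ y → (x, y) ∈ G) ∧
        ∀ x ∈ Aᶜ, ∀ y ∈ Aᶜ, x ⋖ y → (x, y) ∈ B}) :
    (X = ∅ → 𝒜 = {A : Set P | A.Nonempty ∧ ∀ x ∈ A, IsMin x}) ∧
      (X ≠ ∅ → (∃ x ∈ X, ∃ y ∈ X, x ⋖ y ∧ (x, y) ∈ B) → 𝒜 = ∅) ∧
      (X ≠ ∅ → (∀ x ∈ X, ∀ y ∈ X, x ⋖ y → (x, y) ∈ G) →
        𝒜 = {A : Set P | ∃ I ⊆ Y', A = X ∪ I}) := by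
  have hYupper : IsUpperSet Y := hY ▸ isUpperSet_sUnion fun S hS => hS.1
  have hYB : ∀ x ∈ Y, ∀ y, x ⋖ y → (x, y) ∈ B := by
    intro x hx y hxy
    rw [hY] at hx
    obtain ⟨S, ⟨hSupper, hSB⟩, hxS⟩ := hx
    exact hSB x hxS y (hSupper hxy.le hxS) hxy
  have hGB : ∀ p, p ∈ G → p ∉ B := fun _ hp => Set.disjoint_left.1 hdisj hp
  have hXA : ∀ A ∈ 𝒜, X ⊆ A := by
    intro A hA x hx
    rw [h𝒜] at hA
    obtain ⟨-, hAlower, -, hAB⟩ := hA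
    by_contra hxA
    rw [hX, hY] at hx
    exact hx ⟨Aᶜ, ⟨hAlower.compl, hAB⟩, hxA⟩
  have hAmin : ∀ A ∈ 𝒜, ∀ y ∈ A, y ∈ Y → Minimal (· ∈ Y) y := by
    intro A hA y hyA hyY
    rw [h𝒜] at hA
    obtain ⟨-, hAlower, hAG, -⟩ := hA
    refine ⟨hyY, fun z hz hzy => ?_⟩
    by_contra hyz
    obtain ⟨w, hzw, hwy⟩ := exists_le_covBy_of_lt (lt_of_le_not_ge hzy hyz)
    exact hGB _ (hAG w (hAlower hwy.le hyA) y hyA hwy) (hYB w (hYupper hzw hz) y hwy)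
  refine ⟨fun hXe => ?_, fun _ hXB => ?_, fun hXne hXG => ?_⟩
  · have hYuniv : ∀ x, x ∈ Y := by
      intro x
      by_contra hx
      exact (hXe ▸ hX.symm ▸ hx : x ∈ (∅ : Set P))
    ext A
    constructor
    · intro hA
      refine ⟨?_, fun x hx z hzx => (hAmin A hA x hx (hYuniv x)).2 (hYuniv z) hzx⟩
      rw [h𝒜] at hA
      exact hA.1
    · rintro ⟨hne, hmin⟩
      rw [h𝒜]
      refine ⟨hne, fun x z hzx hx => ?_, fun x _ y hy hxy => ?_,
        fun x _ y _ hxy => hYB x (hYuniv x) y hxy⟩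
      · rwa [hzx.antisymm (hmin x hx hzx)]
      · exact absurd hxy.lt (hmin y hy).not_lt
  · obtain ⟨x, hx, y, hy, hxy, hxyB⟩ := hXB
    refine Set.eq_empty_of_forall_notMem fun A hA => ?_
    have hsub := hXA A hA
    rw [h𝒜] at hA
    exact hGB _ (hA.2.2.1 x (hsub hx) y (hsub hy) hxy) hxyB
  · have hXiff : ∀ x, x ∈ X ↔ x ∉ Y := fun x => by rw [hX, Set.mem_compl_iff]
    ext A
    constructor
    · intro hA
      refine ⟨A ∩ Y, fun y hy => ?_, ?_⟩
      · have hmin := hAmin A hA y hy.1 hy.2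
        rw [h𝒜] at hA
        rw [hY']
        exact ⟨hmin, fun x hxy => hA.2.2.1 x (hA.2.1 hxy.le hy.1) y hy.1 hxy⟩
      · ext x
        have hx : x ∈ X → x ∈ A := fun h => hXA A hA h
        have hx' := hXiff x
        simp only [Set.mem_union, Set.mem_inter_iff]
        tauto
    · rintro ⟨I, hI, rfl⟩
      rw [hY'] at hI
      rw [h𝒜]
      refine ⟨(Set.nonempty_iff_ne_empty.2 hXne).inl, ?_, ?_, ?_⟩
      · rintro x z hzx (hx | hx)
        · exact Or.inl ((hXiff z).2 fun hz => (hXiff x).1 hx (hYupper hzx hz))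
        · by_cases hz : z ∈ Y
          · rw [hzx.antisymm ((hI hx).1.2 hz hzx)]
            exact Or.inr hx
          · exact Or.inl ((hXiff z).2 hz)
      · rintro x hx y (hy | hy) hxy
        · exact hXG x ((hXiff x).2 fun h => (hXiff y).1 hy (hYupper hxy.le h)) y hy hxy
        · exact (hI hy).2 x hxy
      · intro x hx y _ hxy
        exact hYB x (by_contra fun h => hx (Or.inl ((hXiff x).2 h))) y hxy
end

section
/- Let P be a finite poset whose set of cover relations C is partitioned as C = G ⊔ B, and assume this partition is acyclic. Define Y, X and Y′ as below. If X ≠ ∅ and every cover relation between two elements of X lies in G, then Y′ ≠ ∅. -/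
open scoped Classical

/-- The final step in the proof of Lemma 3.17: if `X ≠ ∅` and every cover
relation between two elements of `X` is good, then `Y′ ≠ ∅`. -/
theorem Yprime_nonempty {P : Type*} [Fintype P] [PartialOrder P]
    (G B : Set (P × P))
    (hG : ∀ p ∈ G, p.1 ⋖ p.2) (hB : ∀ p ∈ B, p.1 ⋖ p.2)
    (hdisj : Disjoint G B)
    (hcov : ∀ x y : P, x ⋖ y → (x, y) ∈ G ∪ B)
    (hacyc : ∀ x : P,
      ¬ Relation.TransGen (fun a b : P => (a, b) ∈ G ∨ (b, a) ∈ B) x x)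
    (Y : Set P)
    (hY : Y = ⋃₀ {S : Set P | IsUpperSet S ∧ ∀ x ∈ S, ∀ y ∈ S, x ⋖ y → (x, y) ∈ B})
    (X : Set P) (hX : X = Yᶜ)
    (Y' : Set P)
    (hY' : Y' = {y | Minimal (· ∈ Y) y ∧ ∀ x : P, x ⋖ y → (x, y) ∈ G})
    (hXne : X ≠ ∅)
    (hXgood : ∀ x ∈ X, ∀ y ∈ X, x ⋖ y → (x, y) ∈ G) :
    Y' ≠ ∅ := by
  obtain ⟨x₀, -⟩ := Set.nonempty_iff_ne_empty.mpr hXne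
  -- A finite acyclic digraph has a sink.
  obtain ⟨s, hs⟩ : ∃ s : P, ∀ b, ¬ ((s, b) ∈ G ∨ (b, s) ∈ B) := by
    let r : P → P → Prop :=
      fun b a => Relation.TransGen (fun a b : P => (a, b) ∈ G ∨ (b, a) ∈ B) a b
    have : IsTrans P r := ⟨fun _ _ _ hab hbc => hbc.trans hab⟩
    have : Std.Irrefl r := ⟨hacyc⟩
    obtain ⟨s, -, hs⟩ := (Finite.wellFounded_of_trans_of_irrefl r).has_min Set.univ ⟨x₀, trivial⟩
    exact ⟨s, fun b hb => hs b trivial (.single hb)⟩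
  have hsG : ∀ b, (s, b) ∉ G := fun b h => hs b (.inl h)
  have hsB : ∀ b, (b, s) ∉ B := fun b h => hs b (.inr h)
  have hup : IsUpperSet Y := hY ▸ isUpperSet_sUnion fun S hS => hS.1
  have hYB : ∀ a ∈ Y, ∀ b, a ⋖ b → (a, b) ∈ B := by
    intro a ha b hab
    rw [hY] at ha
    obtain ⟨S, ⟨hSup, hSB⟩, haS⟩ := ha
    exact hSB a haS b (hSup hab.le haS) hab
  have hsY : s ∈ Y := by
    by_contra hsY
    refine hsY ?_
    rw [hY]
    refine ⟨Set.Ici s, ⟨isUpperSet_Ici s, fun a ha b _ hab => ?_⟩, le_rfl⟩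
    rcases eq_or_lt_of_le (Set.mem_Ici.mp ha) with rfl | hlt
    · exact (hcov _ _ hab).resolve_left (hsG b)
    · obtain ⟨c, hsc, hca⟩ := exists_covBy_le_of_lt hlt
      have hcY : c ∈ Y := by
        by_contra hcY
        subst hX
        exact hsG c (hXgood s hsY c hcY hsc)
      exact hYB a (hup hca hcY) b hab
  refine Set.nonempty_iff_ne_empty.mp ⟨s, ?_⟩
  rw [hY']
  refine ⟨⟨hsY, fun z hz hzs => ?_⟩, fun x hx => (hcov x s hx).resolve_right (hsB x)⟩
  rcases eq_or_lt_of_le hzs with rfl | hlt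
  · exact le_rfl
  · obtain ⟨c, hzc, hcs⟩ := exists_le_covBy_of_lt hlt
    exact absurd (hYB c (hup hzc hz) s hcs) (hsB c)
end

section
/- Let μ be a nonempty skew Young diagram and let T be a tableau of shape μ. Then the sum of (−1)^{|μ_S|} over all divisions (μ_S, μ_R) of μ allowed by T equals 0. -/
open scoped Classical

/-- A skew Young diagram: a finite set of boxes `(row, column)` with positive
coordinates, closed under taking intervals for the componentwise order on `ℕ × ℕ`. -/
def IsSkewShape (σ : Finset (ℕ × ℕ)) : Prop :=
  (∀ b ∈ σ, 1 ≤ b.1 ∧ 1 ≤ b.2) ∧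
    ∀ b ∈ σ, ∀ b' ∈ σ, ∀ x : ℕ × ℕ, b ≤ x → x ≤ b' → x ∈ σ

/-- The cover relation of the poset of boxes of `σ` (componentwise order). -/
def ShapeCovBy (σ : Finset (ℕ × ℕ)) (b b' : ℕ × ℕ) : Prop :=
  b ∈ σ ∧ b' ∈ σ ∧ b < b' ∧ ∀ x ∈ σ, ¬(b < x ∧ x < b')

/-- `σ` is connected: the Hasse diagram of its poset of boxes is connected. -/
def IsConnectedShape (σ : Finset (ℕ × ℕ)) : Prop :=
  ∀ b ∈ σ, ∀ b' ∈ σ,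
    Relation.ReflTransGen (fun x y => ShapeCovBy σ x y ∨ ShapeCovBy σ y x) b b'

/-- `μ ⊇ σ`: every box of `σ` is a box of `μ`, and every box of `μ` lies in a
column containing a box of `σ`. -/
def Extends (σ μ : Finset (ℕ × ℕ)) : Prop :=
  σ ⊆ μ ∧ ∀ b ∈ μ, ∃ b' ∈ σ, b'.2 = b.2

/-- `A(μ/σ)`: the boxes of `μ \ σ` lying above `σ`. -/
def shapeAbove (σ μ : Finset (ℕ × ℕ)) : Finset (ℕ × ℕ) :=
  (μ \ σ).filter fun b => ∀ b' ∈ σ, b'.2 = b.2 → b.1 < b'.1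

/-- `B(μ/σ)`: the boxes of `μ \ σ` lying below `σ`. -/
def shapeBelow (σ μ : Finset (ℕ × ℕ)) : Finset (ℕ × ℕ) :=
  (μ \ σ).filter fun b => ∀ b' ∈ σ, b'.2 = b.2 → b'.1 < b.1

/-- Labels of a tableau are positive on the shape. -/
def PosOn (σ : Finset (ℕ × ℕ)) (T : ℕ × ℕ → ℕ) : Prop := ∀ b ∈ σ, 1 ≤ T b

/-- A tableau takes the junk value `0` off the shape (used to count tableaux). -/
def ZeroOff (σ : Finset (ℕ × ℕ)) (T : ℕ × ℕ → ℕ) : Prop := ∀ b, b ∉ σ → T b = 0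

/-- Rows weakly increase left to right, columns strictly increase top to bottom. -/
def SemistandardOn (σ : Finset (ℕ × ℕ)) (T : ℕ × ℕ → ℕ) : Prop :=
  (∀ i j j', (i, j) ∈ σ → (i, j') ∈ σ → j < j' → T (i, j) ≤ T (i, j')) ∧
    ∀ i i' j, (i, j) ∈ σ → (i', j) ∈ σ → i < i' → T (i, j) < T (i', j)

/-- Rows strictly decrease left to right, columns weakly decrease top to bottom. -/
def ReverseRowStrictOn (σ : Finset (ℕ × ℕ)) (T : ℕ × ℕ → ℕ) : Prop :=
  (∀ i j j', (i, j) ∈ σ → (i, j') ∈ σ → j < j' → T (i, j') < T (i, j)) ∧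
    ∀ i i' j, (i, j) ∈ σ → (i', j) ∈ σ → i < i' → T (i', j) ≤ T (i, j)

/-- `T(i,j) < i` for every box. -/
def RowBoundedOn (σ : Finset (ℕ × ℕ)) (T : ℕ × ℕ → ℕ) : Prop := ∀ b ∈ σ, T b < b.1

/-- `T(i,j) ≤ i` for every box. -/
def RowWeaklyBoundedOn (σ : Finset (ℕ × ℕ)) (T : ℕ × ℕ → ℕ) : Prop := ∀ b ∈ σ, T b ≤ b.1

/-- The tableau `T` has content `c` on the shape `σ`: label `i` occurs `c i` times. -/
def ContentOn (σ : Finset (ℕ × ℕ)) (T : ℕ × ℕ → ℕ) (c : ℕ →₀ ℕ) : Prop :=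
  ∀ i, (σ.filter fun b => T b = i).card = c i

/-- A set-valued tableau assigns a nonempty set of positive integers to each box. -/
def SVPosOn (σ : Finset (ℕ × ℕ)) (T : ℕ × ℕ → Finset ℕ) : Prop :=
  ∀ b ∈ σ, (T b).Nonempty ∧ ∀ a ∈ T b, 1 ≤ a

/-- A set-valued tableau takes the junk value `∅` off the shape. -/
def SVEmptyOff (σ : Finset (ℕ × ℕ)) (T : ℕ × ℕ → Finset ℕ) : Prop :=
  ∀ b, b ∉ σ → T b = ∅

/-- Semistandardness for set-valued tableaux: rows weakly increase (`max ≤ min`)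
left to right and columns strictly increase (`max < min`) top to bottom. -/
def SVSemistandardOn (σ : Finset (ℕ × ℕ)) (T : ℕ × ℕ → Finset ℕ) : Prop :=
  (∀ i j j', (i, j) ∈ σ → (i, j') ∈ σ → j < j' →
      ∀ a ∈ T (i, j), ∀ a' ∈ T (i, j'), a ≤ a') ∧
    ∀ i i' j, (i, j) ∈ σ → (i', j) ∈ σ → i < i' →
      ∀ a ∈ T (i, j), ∀ a' ∈ T (i', j), a < a'

/-- The set-valued tableau `T` has content `c`: label `i` occurs `c i` times. -/
def SVContentOn (σ : Finset (ℕ × ℕ)) (T : ℕ × ℕ → Finset ℕ) (c : ℕ →₀ ℕ) : Prop :=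
  ∀ i, (σ.filter fun b => i ∈ T b).card = c i

/-- The set-valued tableau `T` has excess `e`: the number of labels in row `r`
equals the number of boxes in row `r` plus `e r`. -/
def SVExcessOn (σ : Finset (ℕ × ℕ)) (T : ℕ × ℕ → Finset ℕ) (e : ℕ → ℕ) : Prop :=
  ∀ r, (∑ b ∈ σ.filter (fun b => b.1 = r), (T b).card)
      = (σ.filter (fun b => b.1 = r)).card + e r

/-- `|SS_{c,e}(σ)|`: the number of semistandard set-valued tableaux of shape `σ`
with content `c` and excess `e`. -/
noncomputable def svtCount (σ : Finset (ℕ × ℕ)) (c : ℕ →₀ ℕ) (e : ℕ → ℕ) : ℕ :=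
  Set.ncard {T : ℕ × ℕ → Finset ℕ |
    SVEmptyOff σ T ∧ SVPosOn σ T ∧ SVSemistandardOn σ T ∧
      SVContentOn σ T c ∧ SVExcessOn σ T e}

/-- The number of semistandard set-valued tableaux of shape `σ` with content `c`
(arbitrary excess). -/
noncomputable def svtCountAll (σ : Finset (ℕ × ℕ)) (c : ℕ →₀ ℕ) : ℕ :=
  Set.ncard {T : ℕ × ℕ → Finset ℕ |
    SVEmptyOff σ T ∧ SVPosOn σ T ∧ SVSemistandardOn σ T ∧ SVContentOn σ T c}

/-- The number of ordinary semistandard tableaux of shape `μ` with content `c`. -/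
noncomputable def ssytCount (μ : Finset (ℕ × ℕ)) (c : ℕ →₀ ℕ) : ℕ :=
  Set.ncard {T : ℕ × ℕ → ℕ |
    ZeroOff μ T ∧ PosOn μ T ∧ SemistandardOn μ T ∧ ContentOn μ T c}

/-- `|c| = Σ cᵢ` for a content `c`. -/
def csize (c : ℕ →₀ ℕ) : ℕ := c.sum fun _ n => n

/-- The division `(S, μ \ S)` of `μ` is allowed by `T`. -/
def IsAllowedDivision (μ : Finset (ℕ × ℕ)) (T : ℕ × ℕ → ℕ) (S : Finset (ℕ × ℕ)) : Prop :=
  (∀ b ∈ S, ∀ b' ∈ μ, b' ≤ b → b' ∈ S) ∧ SemistandardOn S T ∧ ReverseRowStrictOn (μ \ S) T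

/-- Some box carrying the largest label has smaller labels to its right in its row and
above it in its column. -/
theorem exists_northeast_max (μ : Finset (ℕ × ℕ)) (hne : μ.Nonempty) (T : ℕ × ℕ → ℕ) :
    ∃ i j, (i, j) ∈ μ ∧ (∀ x ∈ μ, T x ≤ T (i, j)) ∧
      (∀ j', (i, j') ∈ μ → j < j' → T (i, j') < T (i, j)) ∧
      ∀ i', (i', j) ∈ μ → i' < i → T (i', j) < T (i, j) := by
  obtain ⟨m, hm, hmax⟩ := μ.exists_max_image T hne
  obtain ⟨⟨i, j⟩, hb, hcontent⟩ :=
    (μ.filter fun x => T x = T m).exists_max_image (fun x => (x.2 : ℤ) - x.1)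
      ⟨m, by simp [hm]⟩
  rw [Finset.mem_filter] at hb
  refine ⟨i, j, hb.1, fun x hx => hb.2 ▸ hmax x hx, fun j' hj' hlt => ?_, fun i' hi' hlt => ?_⟩
  · refine lt_of_le_of_ne (hb.2 ▸ hmax _ hj') fun h => ?_
    have := hcontent (i, j') (Finset.mem_filter.2 ⟨hj', h.trans hb.2⟩)
    simp only at this
    omega
  · refine lt_of_le_of_ne (hb.2 ▸ hmax _ hi') fun h => ?_
    have := hcontent (i', j) (Finset.mem_filter.2 ⟨hi', h.trans hb.2⟩)
    simp only at this
    omega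

section Toggle

variable {μ S : Finset (ℕ × ℕ)} {T : ℕ × ℕ → ℕ} {i j : ℕ}

theorem IsAllowedDivision.insert (hμ : IsSkewShape μ) (hb : (i, j) ∈ μ)
    (hmax : ∀ x ∈ μ, T x ≤ T (i, j))
    (habove : ∀ i', (i', j) ∈ μ → i' < i → T (i', j) < T (i, j))
    (hS : S ⊆ μ) (hbS : (i, j) ∉ S) (h : IsAllowedDivision μ T S) :
    IsAllowedDivision μ T (insert (i, j) S) := by
  obtain ⟨hideal, ⟨hrow, hcol⟩, hrrow, hrcol⟩ := h
  refine ⟨?_, ⟨?_, ?_⟩, ?_, ?_⟩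
  · intro x hx y hy hyx
    rw [Finset.mem_insert] at hx ⊢
    rcases hx with rfl | hx
    · by_contra! hcon
      obtain ⟨p, q⟩ := y
      obtain ⟨hp, hq⟩ : p ≤ i ∧ q ≤ j := hyx
      have mem_R : ∀ z ∈ μ, (p, q) ≤ z → z ∈ μ \ S := fun z hz hle =>
        Finset.mem_sdiff.2 ⟨hz, fun hzS => hcon.2 (hideal z hzS _ hy hle)⟩
      have hbR := mem_R _ hb ⟨hp, hq⟩
      rcases hq.lt_or_eq with hlt | rfl
      · have hz : (i, q) ∈ μ := hμ.2 _ hy _ hb _ ⟨hp, le_rfl⟩ ⟨le_rfl, hq⟩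
        have := hrrow i q j (mem_R _ hz ⟨hp, le_rfl⟩) hbR hlt
        have := hmax _ hz
        omega
      · have hlt : p < i := lt_of_le_of_ne hp fun h => hcon.1 (by rw [h])
        have := hrcol p i q (mem_R _ hy le_rfl) hbR hlt
        have := habove p hy hlt
        omega
    · exact Or.inr (hideal x hx y hy hyx)
  · intro r c c' h₁ h₂ hlt
    rw [Finset.mem_insert] at h₁ h₂
    rcases h₂ with h₂ | h₂
    · rw [h₂]
      rcases h₁ with h₁ | h₁
      · rw [h₁]
      · exact hmax _ (hS h₁)
    · rcases h₁ with h₁ | h₁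
      · exact absurd (hideal _ h₂ _ hb (h₁ ▸ ⟨le_rfl, hlt.le⟩)) hbS
      · exact hrow r c c' h₁ h₂ hlt
  · intro r r' c h₁ h₂ hlt
    rw [Finset.mem_insert] at h₁ h₂
    rcases h₂ with h₂ | h₂
    · obtain ⟨rfl, rfl⟩ := Prod.mk.inj h₂
      rcases h₁ with h₁ | h₁
      · exact absurd (Prod.mk.inj h₁).1 hlt.ne
      · exact habove r (hS h₁) hlt
    · rcases h₁ with h₁ | h₁
      · exact absurd (hideal _ h₂ _ hb (h₁ ▸ ⟨hlt.le, le_rfl⟩)) hbS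
      · exact hcol r r' c h₁ h₂ hlt
  · intro r c c' h₁ h₂
    simp only [Finset.mem_sdiff, Finset.mem_insert, not_or] at h₁ h₂
    exact hrrow r c c' (Finset.mem_sdiff.2 ⟨h₁.1, h₁.2.2⟩) (Finset.mem_sdiff.2 ⟨h₂.1, h₂.2.2⟩)
  · intro r r' c h₁ h₂
    simp only [Finset.mem_sdiff, Finset.mem_insert, not_or] at h₁ h₂
    exact hrcol r r' c (Finset.mem_sdiff.2 ⟨h₁.1, h₁.2.2⟩) (Finset.mem_sdiff.2 ⟨h₂.1, h₂.2.2⟩)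

theorem IsAllowedDivision.of_insert (hμ : IsSkewShape μ) (hb : (i, j) ∈ μ)
    (hmax : ∀ x ∈ μ, T x ≤ T (i, j))
    (hright : ∀ j', (i, j') ∈ μ → j < j' → T (i, j') < T (i, j))
    (hS : S ⊆ μ) (hbS : (i, j) ∉ S) (h : IsAllowedDivision μ T (Insert.insert (i, j) S)) :
    IsAllowedDivision μ T S := by
  obtain ⟨hideal, ⟨hrow, hcol⟩, hrrow, hrcol⟩ := h
  have hbI : (i, j) ∈ Insert.insert (i, j) S := Finset.mem_insert_self _ _
  have mem_R : ∀ z ∈ μ \ S, z = (i, j) ∨ z ∈ μ \ Insert.insert (i, j) S := by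
    intro z hz
    simp only [Finset.mem_sdiff, Finset.mem_insert] at hz ⊢
    tauto
  have not_le : ∀ z ∈ μ \ S, z ≠ (i, j) → ¬ z ≤ (i, j) := fun z hz hne hle =>
    (Finset.mem_sdiff.1 hz).2
      (Finset.mem_of_mem_insert_of_ne (hideal _ hbI z (Finset.mem_sdiff.1 hz).1 hle) hne)
  refine ⟨?_, ⟨?_, ?_⟩, ?_, ?_⟩
  · intro x hx y hy hyx
    refine Finset.mem_of_mem_insert_of_ne
      (hideal x (Finset.mem_insert_of_mem hx) y hy hyx) ?_
    rintro rfl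
    obtain ⟨p, q⟩ := x
    obtain ⟨hp, hq⟩ : i ≤ p ∧ j ≤ q := hyx
    rcases hq.lt_or_eq with hlt | rfl
    · have hz : (i, q) ∈ μ := hμ.2 _ hb _ (hS hx) _ ⟨le_rfl, hq⟩ ⟨hp, le_rfl⟩
      have hzI := hideal _ (Finset.mem_insert_of_mem hx) _ hz ⟨hp, le_rfl⟩
      have := hrow i j q hbI hzI hlt
      have := hright q hz hlt
      omega
    · have hlt : i < p := lt_of_le_of_ne hp fun h => hbS (by rwa [h])
      have := hcol i p j hbI (Finset.mem_insert_of_mem hx) hlt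
      have := hmax _ (hS hx)
      omega
  · exact fun r c c' h₁ h₂ =>
      hrow r c c' (Finset.mem_insert_of_mem h₁) (Finset.mem_insert_of_mem h₂)
  · exact fun r r' c h₁ h₂ =>
      hcol r r' c (Finset.mem_insert_of_mem h₁) (Finset.mem_insert_of_mem h₂)
  · intro r c c' h₁ h₂ hlt
    rcases mem_R _ h₂ with h₂' | h₂'
    · obtain ⟨rfl, rfl⟩ := Prod.mk.inj h₂'
      exact absurd ⟨le_rfl, hlt.le⟩ (not_le _ h₁ (by simp [hlt.ne]))
    · rcases mem_R _ h₁ with h₁' | h₁'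
      · obtain ⟨rfl, rfl⟩ := Prod.mk.inj h₁'
        exact hright c' (Finset.mem_sdiff.1 h₂).1 hlt
      · exact hrrow r c c' h₁' h₂' hlt
  · intro r r' c h₁ h₂ hlt
    rcases mem_R _ h₂ with h₂' | h₂'
    · obtain ⟨rfl, rfl⟩ := Prod.mk.inj h₂'
      exact absurd ⟨hlt.le, le_rfl⟩ (not_le _ h₁ (by simp [hlt.ne]))
    · rcases mem_R _ h₁ with h₁' | h₁'
      · rw [h₁']
        exact hmax _ (Finset.mem_sdiff.1 h₂).1
      · exact hrcol r r' c h₁' h₂' hlt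

end Toggle

/-- Lemma 4.2: for a nonempty skew shape `μ` and a tableau `T` on `μ`, the signed
count of divisions `μ = μ_S ⊔ μ_R` allowed by `T` (i.e. `μ_S` an order ideal of `μ`
on which `T` is semistandard, and `T` reverse row-strict on `μ_R = μ \ μ_S`) is zero. -/
theorem division_signed_sum_zero
    (μ : Finset (ℕ × ℕ)) (hμ : IsSkewShape μ) (hne : μ.Nonempty)
    (T : ℕ × ℕ → ℕ) (hT : PosOn μ T) :
    (∑ μS ∈ μ.powerset,
        if (∀ b ∈ μS, ∀ b' ∈ μ, b' ≤ b → b' ∈ μS) ∧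
            SemistandardOn μS T ∧ ReverseRowStrictOn (μ \ μS) T then
          (-1 : ℤ) ^ μS.card
        else 0) = 0 := by
  obtain ⟨i, j, hb, hmax, hright, habove⟩ := exists_northeast_max μ hne T
  suffices h : ∑ S ∈ μ.powerset,
      (if IsAllowedDivision μ T S then (-1 : ℤ) ^ S.card else 0) = 0 by
    refine Eq.trans ?_ h
    exact Finset.sum_congr rfl fun S _ => if_congr Iff.rfl rfl rfl
  rw [← Finset.insert_erase hb, Finset.sum_powerset_insert (Finset.notMem_erase _ _),
    Finset.insert_erase hb, ← Finset.sum_add_distrib]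
  refine Finset.sum_eq_zero fun S hS => ?_
  obtain ⟨hSμ, hbS⟩ := Finset.subset_erase.1 (Finset.mem_powerset.1 hS)
  have toggle : IsAllowedDivision μ T (insert (i, j) S) ↔ IsAllowedDivision μ T S :=
    ⟨.of_insert hμ hb hmax hright hSμ hbS, .insert hμ hb hmax habove hSμ hbS⟩
  simp only [toggle, Finset.card_insert_of_notMem hbS, pow_succ]
  split_ifs <;> ring
end

section
/- Let λ be a skew Young diagram and let T′ be a tableau of shape λ. Orient each pair of adjacent boxes of λ as follows: for boxes b and b′ with b′ directly to the right of b, put an edge b′ → b if T′(b) > T′(b′) and an edge b → b′ if T′(b) ≤ T′(b′); for boxes b and b′ with b′ directly below b, put an edge b′ → b if T′(b) ≥ T′(b′) and an edge b → b′ if T′(b) < T′(b′). Then the resulting directed graph on the boxes of λ has no directed cycle. -/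
open scoped Classical

/-- The orientation of adjacent boxes of a shape `lam` determined by a tableau `T`:
for `b'` directly to the right of `b`, an edge `b → b'` if `T b ≤ T b'` and an edge
`b' → b` if `T b > T b'`; for `b'` directly below `b`, an edge `b → b'` if
`T b < T b'` and an edge `b' → b` if `T b ≥ T b'`. -/
def TabEdge (lam : Finset (ℕ × ℕ)) (T : ℕ × ℕ → ℕ) (x y : ℕ × ℕ) : Prop :=
  x ∈ lam ∧ y ∈ lam ∧
    ((y.1 = x.1 ∧ y.2 = x.2 + 1 ∧ T x ≤ T y) ∨
      (x.1 = y.1 ∧ x.2 = y.2 + 1 ∧ T x < T y) ∨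
      (y.1 = x.1 + 1 ∧ y.2 = x.2 ∧ T x < T y) ∨
      (x.1 = y.1 + 1 ∧ x.2 = y.2 ∧ T x ≤ T y))

/-- Along a path the pair (label, column minus row) strictly increases lexicographically. -/
theorem TabEdge.transGen_lt {lam : Finset (ℕ × ℕ)} {T : ℕ × ℕ → ℕ} {x y : ℕ × ℕ}
    (h : Relation.TransGen (TabEdge lam T) x y) :
    T x < T y ∨ (T x = T y ∧ x.2 + y.1 < y.2 + x.1) := by
  induction h with
  | single h =>
    obtain ⟨-, -, h⟩ := h
    omega
  | tail _ h ih =>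
    obtain ⟨-, -, h⟩ := h
    omega

/-- The orientation of the adjacency graph of a skew shape determined by any
tableau is acyclic (used in the proof of Theorem 3.6). -/
theorem tab_orientation_acyclic
    (lam : Finset (ℕ × ℕ)) (hlam : IsSkewShape lam)
    (T : ℕ × ℕ → ℕ) (hT : PosOn lam T) :
    ∀ b : ℕ × ℕ, ¬ Relation.TransGen (TabEdge lam T) b b := by
  intro b h
  have := TabEdge.transGen_lt h
  omega
end

section
/- Let λ be a skew Young diagram and let T′ be a tableau of shape λ. Call a subset I ⊆ λ right-down-closed if whenever b ∈ I and b′ ∈ λ is directly to the right of or directly below b, then b′ ∈ I. Consider all sequences ∅ = I₀ ⊊ I₁ ⊊ ⋯ ⊊ I_ℓ = λ of right-down-closed subsets such that for each i and any two boxes b, b′ ∈ I_i ∖ I_{i−1}: if b′ is directly to the right of b then T′(b) > T′(b′), and if b′ is directly below b then T′(b) ≥ T′(b′). Then the sum of (−1)^ℓ over all such sequences equals (−1)^{|λ|} if T′ is semistandard, and equals 0 otherwise. -/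
open scoped Classical

/-- `I` is right-down-closed in `lam`: closed under passing to the box directly to
the right or directly below, within `lam`. -/
def RightDownClosed (lam I : Finset (ℕ × ℕ)) : Prop :=
  ∀ b ∈ I, ∀ b' ∈ lam,
    ((b'.1 = b.1 ∧ b'.2 = b.2 + 1) ∨ (b'.1 = b.1 + 1 ∧ b'.2 = b.2)) → b' ∈ I

section SignedChains

variable {α : Type*} [DecidableEq α]

/-- The strictly increasing chains `∅ = I₀, …, I_ℓ = S` of finite sets all of whose steps are
related by `step`. -/
noncomputable def stepChains (step : Finset α → Finset α → Prop) :
    (ℓ : ℕ) → Finset α → Finset (Fin (ℓ + 1) → Finset α)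
  | 0, S => if S = ∅ then {fun _ => ∅} else ∅
  | ℓ + 1, S => (S.ssubsets.filter fun J => step J S).biUnion fun J =>
      (stepChains step ℓ J).image fun I => Fin.snoc (α := fun _ => Finset α) I S

theorem mem_stepChains {step : Finset α → Finset α → Prop} {ℓ : ℕ} {S : Finset α}
    {I : Fin (ℓ + 1) → Finset α} :
    I ∈ stepChains step ℓ S ↔ I 0 = ∅ ∧ I (Fin.last ℓ) = S ∧
      ∀ i : Fin ℓ, I i.castSucc ⊂ I i.succ ∧ step (I i.castSucc) (I i.succ) := by
  induction ℓ generalizing S with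
  | zero =>
    simp only [stepChains]
    constructor
    · split_ifs with h
      · intro hI
        rw [Finset.mem_singleton] at hI
        subst hI
        exact ⟨rfl, h.symm, fun i => i.elim0⟩
      · simp
    · rintro ⟨h0, h1, -⟩
      have hS : S = ∅ := by rw [← h1, ← h0]; rfl
      rw [if_pos hS, Finset.mem_singleton]
      funext i
      rw [show i = 0 from Fin.fin_one_eq_zero i, h0]
  | succ ℓ ih =>
    simp only [stepChains, Finset.mem_biUnion, Finset.mem_filter, Finset.mem_ssubsets,
      Finset.mem_image, ih]
    constructor
    · rintro ⟨J, ⟨hJ, hs⟩, I', ⟨h0, hl, hst⟩, rfl⟩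
      refine ⟨?_, Fin.snoc_last _ _, fun i => ?_⟩
      · rw [← Fin.castSucc_zero, Fin.snoc_castSucc, h0]
      · induction i using Fin.lastCases with
        | last => rw [Fin.succ_last, Fin.snoc_last, Fin.snoc_castSucc, hl]; exact ⟨hJ, hs⟩
        | cast i =>
          rw [Fin.succ_castSucc, Fin.snoc_castSucc, Fin.snoc_castSucc]
          exact hst i
    · rintro ⟨h0, hl, hst⟩
      have hlast := hst (Fin.last ℓ)
      rw [Fin.succ_last, hl] at hlast
      refine ⟨I (Fin.last ℓ).castSucc, hlast, Fin.init I, ⟨h0, rfl, fun i => ?_⟩, ?_⟩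
      · exact hst i.castSucc
      · rw [← hl]
        exact Fin.snoc_init_self I

theorem card_stepChains_succ (step : Finset α → Finset α → Prop) (ℓ : ℕ) (S : Finset α) :
    (stepChains step (ℓ + 1) S).card =
      ∑ J ∈ S.ssubsets.filter (fun J => step J S), (stepChains step ℓ J).card := by
  rw [stepChains, Finset.card_biUnion]
  · refine Finset.sum_congr rfl fun J _ => Finset.card_image_of_injective _ fun I I' h => ?_
    exact (Fin.snoc_inj.1 h).1
  · intro J _ J' _ hne
    refine Finset.disjoint_left.2 fun I hI hI' => hne ?_
    obtain ⟨K, hK, rfl⟩ := Finset.mem_image.1 hI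
    obtain ⟨K', hK', h⟩ := Finset.mem_image.1 hI'
    rw [← (mem_stepChains.1 hK).2.1, ← (mem_stepChains.1 hK').2.1, (Fin.snoc_inj.1 h).1]

theorem stepChains_eq_empty {step : Finset α → Finset α → Prop} {ℓ : ℕ} {S : Finset α}
    (h : S.card < ℓ) : stepChains step ℓ S = ∅ := by
  induction ℓ generalizing S with
  | zero => omega
  | succ ℓ ih =>
    rw [← Finset.card_eq_zero, card_stepChains_succ]
    refine Finset.sum_eq_zero fun J hJ => ?_
    have := Finset.card_lt_card (Finset.mem_ssubsets.1 (Finset.mem_filter.1 hJ).1)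
    rw [ih (by omega), Finset.card_empty]

/-- The signed number of chains with at most `N - 1` steps satisfies the recursion obtained by
deleting the last step. -/
theorem sum_stepChains_succ (step : Finset α → Finset α → Prop) (N : ℕ) (S : Finset α) :
    ∑ ℓ ∈ Finset.range (N + 1), (-1 : ℤ) ^ ℓ * (stepChains step ℓ S).card =
      (if S = ∅ then 1 else 0) - ∑ J ∈ S.ssubsets.filter (fun J => step J S),
        ∑ ℓ ∈ Finset.range N, (-1 : ℤ) ^ ℓ * (stepChains step ℓ J).card := by
  rw [Finset.sum_range_succ', Finset.sum_comm, add_comm, sub_eq_add_neg, ← Finset.sum_neg_distrib]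
  congr 1
  · by_cases h : S = ∅ <;> simp [stepChains, h]
  · refine Finset.sum_congr rfl fun ℓ _ => ?_
    rw [card_stepChains_succ, ← Finset.mul_sum]
    push_cast
    ring

/-- If all partial sums of `v` over predecessors cancel, then `v` is the signed chain count. -/
theorem sum_stepChains_eq {step : Finset α → Finset α → Prop} {ok : Finset α → Prop}
    (hok : ∀ J S, step J S → ok J) {v : Finset α → ℤ} (hv : v ∅ = 1)
    (hrec : ∀ S, ok S → S.Nonempty →
      v S + ∑ J ∈ S.ssubsets.filter (fun J => step J S), v J = 0)
    {N : ℕ} {S : Finset α} (hS : ok S) (hN : S.card < N) :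
    ∑ ℓ ∈ Finset.range N, (-1 : ℤ) ^ ℓ * (stepChains step ℓ S).card = v S := by
  induction N generalizing S with
  | zero => omega
  | succ N ih =>
    rw [sum_stepChains_succ]
    have hsum : ∑ J ∈ S.ssubsets.filter (fun J => step J S),
        ∑ ℓ ∈ Finset.range N, (-1 : ℤ) ^ ℓ * (stepChains step ℓ J).card =
        ∑ J ∈ S.ssubsets.filter (fun J => step J S), v J := by
      refine Finset.sum_congr rfl fun J hJ => ?_
      obtain ⟨h1, h2⟩ := Finset.mem_filter.1 hJ
      have := Finset.card_lt_card (Finset.mem_ssubsets.1 h1)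
      exact ih (hok J S h2) (by omega)
    rw [hsum]
    rcases S.eq_empty_or_nonempty with rfl | hne
    · rw [Finset.sum_eq_zero fun J hJ => ?_, if_pos rfl, hv, sub_zero]
      exact absurd (Finset.mem_ssubsets.1 (Finset.mem_filter.1 hJ).1) (Finset.not_ssubset_empty J)
    · have := hrec S hS hne
      rw [if_neg hne.ne_empty]
      linarith

/-- Toggling the element of least weight cancels the signed sum over the ways of cutting `S`
into a weight-decreasing part and a closed weight-increasing part. -/
theorem sum_increasing_decreasing_eq_zero {β : Type*} [LinearOrder β] (w : α → β)
    {E : α → α → Prop} (hE : ∀ b c, E b c → w b ≠ w c) {lam S : Finset α} (hSlam : S ⊆ lam)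
    (hS : ∀ b ∈ S, ∀ c ∈ lam, E b c → c ∈ S) (hne : S.Nonempty) :
    ∑ J ∈ S.powerset.filter (fun J => (∀ b ∈ J, ∀ c ∈ lam, E b c → c ∈ J) ∧
        (∀ b ∈ S \ J, ∀ c ∈ S \ J, E b c → w c < w b) ∧
        ∀ b ∈ J, ∀ c ∈ J, E b c → w b < w c), (-1 : ℤ) ^ J.card = 0 := by
  obtain ⟨m, hm, hmin⟩ := S.exists_min_image w hne
  refine Finset.sum_involution (fun J _ => if m ∈ J then J.erase m else insert m J) ?_ ?_ ?_ ?_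
  · intro J _
    by_cases h : m ∈ J
    · rw [if_pos h, ← Finset.card_erase_add_one h, pow_succ]
      ring
    · rw [if_neg h, Finset.card_insert_of_notMem h, pow_succ]
      ring
  · intro J _ _ heq
    by_cases h : m ∈ J
    · rw [if_pos h] at heq
      exact Finset.notMem_erase m J (heq.symm ▸ h)
    · rw [if_neg h] at heq
      exact h (heq ▸ Finset.mem_insert_self m J)
  · intro J hJ
    simp only [Finset.mem_filter, Finset.mem_powerset, Finset.mem_sdiff] at hJ ⊢
    obtain ⟨hsub, hcl, hdec, hinc⟩ := hJ
    have hirr : ∀ b c, E b c → b ≠ c := fun b c h hbc => hE b c h (hbc ▸ rfl)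
    by_cases h : m ∈ J
    · simp only [if_pos h, Finset.mem_erase]
      refine ⟨(Finset.erase_subset _ _).trans hsub, ?_, ?_, ?_⟩
      · rintro b ⟨hbm, hb⟩ c hc hbc
        have hcJ := hcl b hb c hc hbc
        refine ⟨?_, hcJ⟩
        rintro rfl
        exact absurd (hinc b hb c hcJ hbc) (not_lt.2 (hmin b (hsub hb)))
      · rintro b ⟨hb, hbJ⟩ c ⟨hc, hcJ⟩ hbc
        by_cases hcm : c = m
        · subst hcm
          exact lt_of_le_of_ne (hmin b hb) (hE _ _ hbc).symm
        · have hcJ' : c ∉ J := fun hh => hcJ ⟨hcm, hh⟩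
          by_cases hbm : b = m
          · subst hbm
            exact absurd (hcl b h c (hSlam hc) hbc) hcJ'
          · exact hdec b ⟨hb, fun hh => hbJ ⟨hbm, hh⟩⟩ c ⟨hc, hcJ'⟩ hbc
      · rintro b ⟨-, hb⟩ c ⟨-, hc⟩ hbc
        exact hinc b hb c hc hbc
    · simp only [if_neg h, Finset.mem_insert, not_or]
      refine ⟨Finset.insert_subset hm hsub, ?_, ?_, ?_⟩
      · rintro b (rfl | hb) c hc hbc
        · right
          by_contra hcJ
          have hcS := hS b hm c hc hbc
          exact absurd (hdec b ⟨hm, h⟩ c ⟨hcS, hcJ⟩ hbc) (not_lt.2 (hmin c hcS))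
        · exact Or.inr (hcl b hb c hc hbc)
      · rintro b ⟨hb, -, hbJ⟩ c ⟨hc, -, hcJ⟩ hbc
        exact hdec b ⟨hb, hbJ⟩ c ⟨hc, hcJ⟩ hbc
      · rintro b (rfl | hb) c (rfl | hc) hbc
        · exact absurd rfl (hirr _ _ hbc)
        · exact lt_of_le_of_ne (hmin c (hsub hc)) (hE _ _ hbc)
        · exact absurd (hcl b hb c (hSlam hm) hbc) h
        · exact hinc b hb c hc hbc
  · intro J _
    by_cases h : m ∈ J
    · simp [h, Finset.insert_erase h]
    · simp [h, Finset.erase_insert h]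

theorem add_sum_ssubsets_filter (f : Finset α → ℤ) {step : Finset α → Finset α → Prop}
    {S : Finset α} (hS : step S S) :
    f S + ∑ J ∈ S.ssubsets.filter (fun J => step J S), f J =
      ∑ J ∈ S.powerset.filter (fun J => step J S), f J := by
  rw [← Finset.sum_insert (f := f) (by simp)]
  refine Finset.sum_congr (Finset.ext fun J => ?_) fun _ _ => rfl
  simp only [Finset.mem_insert, Finset.mem_filter, Finset.mem_ssubsets, Finset.mem_powerset]
  constructor
  · rintro (rfl | ⟨h1, h2⟩)
    · exact ⟨subset_rfl, hS⟩
    · exact ⟨h1.subset, h2⟩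
  · rintro ⟨h1, h2⟩
    exact (eq_or_ssubset_of_subset h1).imp_right fun h => ⟨h, h2⟩

/-- The signed count of chains of closed subsets of `lam` with weight-decreasing steps. -/
theorem sum_stepChains_closed {β : Type*} [LinearOrder β] (w : α → β)
    {E : α → α → Prop} (hE : ∀ b c, E b c → w b ≠ w c) {lam : Finset α}
    {ok : Finset α → Prop}
    (hok : ∀ J, ok J ↔ J ⊆ lam ∧ ∀ b ∈ J, ∀ c ∈ lam, E b c → c ∈ J)
    {step : Finset α → Finset α → Prop}
    (hstep : ∀ J S, step J S ↔ ok J ∧ ok S ∧ ∀ b ∈ S \ J, ∀ c ∈ S \ J, E b c → w c < w b)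
    {N : ℕ} (hN : lam.card < N) :
    ∑ ℓ ∈ Finset.range N, (-1 : ℤ) ^ ℓ * (stepChains step ℓ lam).card =
      if ∀ b ∈ lam, ∀ c ∈ lam, E b c → w b < w c then (-1 : ℤ) ^ lam.card else 0 := by
  obtain ⟨v, hv⟩ : ∃ v : Finset α → ℤ, ∀ S, v S =
      if ∀ b ∈ S, ∀ c ∈ S, E b c → w b < w c then (-1 : ℤ) ^ S.card else 0 := ⟨_, fun _ => rfl⟩
  rw [← hv lam]
  refine sum_stepChains_eq (ok := ok) (fun J S h => ((hstep J S).1 h).1) (by simp [hv]) (fun S hS hne => ?_)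
    ((hok lam).2 ⟨subset_rfl, fun _ _ c hc _ => hc⟩) hN
  obtain ⟨hSlam, hScl⟩ := (hok S).1 hS
  refine Eq.trans ?_ (sum_increasing_decreasing_eq_zero w hE hSlam hScl hne)
  rw [add_sum_ssubsets_filter v ((hstep S S).2 ⟨hS, hS, by simp⟩)]
  simp only [hv]
  rw [← Finset.sum_filter]
  refine Finset.sum_congr (Finset.ext fun J => ?_) fun _ _ => rfl
  simp only [Finset.mem_filter, Finset.mem_powerset, hstep]
  constructor
  · rintro ⟨⟨hJS, h1, -, h2⟩, h3⟩
    exact ⟨hJS, ((hok J).1 h1).2, h2, h3⟩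
  · rintro ⟨hJS, h1, h2, h3⟩
    exact ⟨⟨hJS, (hok J).2 ⟨hJS.trans hSlam, h1⟩, hS, h2⟩, h3⟩

theorem finsum_stepChains (step : Finset α → Finset α → Prop) (S : Finset α)
    (P : (ℓ : ℕ) → (Fin (ℓ + 1) → Finset α) → Prop) [∀ ℓ I, Decidable (P ℓ I)]
    (hP : ∀ ℓ I, P ℓ I ↔ I ∈ stepChains step ℓ S) :
    (∑ᶠ ℓ : ℕ, ∑ᶠ I : Fin (ℓ + 1) → Finset α, if P ℓ I then (-1 : ℤ) ^ ℓ else 0) =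
      ∑ ℓ ∈ Finset.range (S.card + 1), (-1 : ℤ) ^ ℓ * (stepChains step ℓ S).card := by
  have hinner : ∀ ℓ : ℕ, (∑ᶠ I : Fin (ℓ + 1) → Finset α, if P ℓ I then (-1 : ℤ) ^ ℓ else 0) =
      (-1 : ℤ) ^ ℓ * (stepChains step ℓ S).card := by
    intro ℓ
    rw [finsum_eq_sum_of_support_subset (s := stepChains step ℓ S)]
    · rw [Finset.sum_congr rfl fun I hI => if_pos ((hP ℓ I).2 hI), Finset.sum_const, nsmul_eq_mul,
        mul_comm]
    · intro I hI
      rw [Function.mem_support] at hI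
      exact (hP ℓ I).1 (by_contra fun h => hI (if_neg h))
  simp_rw [hinner]
  refine finsum_eq_sum_of_support_subset _ fun ℓ hℓ => ?_
  rw [Finset.coe_range, Set.mem_Iio]
  by_contra h
  exact hℓ (by simp [stepChains_eq_empty (step := step) (show S.card < ℓ by omega)])

end SignedChains

/-- The box `c` is directly to the right of or directly below `b`. -/
def NextBox (b c : ℕ × ℕ) : Prop :=
  (c.1 = b.1 ∧ c.2 = b.2 + 1) ∨ (c.1 = b.1 + 1 ∧ c.2 = b.2)

/-- Boxes weighted by their label, ties being broken by the diagonal. -/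
def boxWeight (T : ℕ × ℕ → ℕ) (b : ℕ × ℕ) : ℕ ×ₗ ℤ := toLex (T b, (b.2 : ℤ) - b.1)

theorem boxWeight_lt {T : ℕ × ℕ → ℕ} {b c : ℕ × ℕ} :
    boxWeight T b < boxWeight T c ↔
      T b < T c ∨ T b = T c ∧ (b.2 : ℤ) - b.1 < (c.2 : ℤ) - c.1 := by
  simp [boxWeight, Prod.Lex.toLex_lt_toLex]

theorem boxWeight_ne {T : ℕ × ℕ → ℕ} {b c : ℕ × ℕ} (h : NextBox b c) :
    boxWeight T b ≠ boxWeight T c := by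
  intro heq
  have h2 : (b.2 : ℤ) - b.1 = (c.2 : ℤ) - c.1 :=
    congrArg (fun x => (ofLex x).2) heq
  rcases h with ⟨h3, h4⟩ | ⟨h3, h4⟩ <;> omega

theorem boxWeight_decreasing_iff {T : ℕ × ℕ → ℕ} {b c : ℕ × ℕ} :
    (NextBox b c → boxWeight T c < boxWeight T b) ↔
      (c.1 = b.1 ∧ c.2 = b.2 + 1 → T c < T b) ∧ (c.1 = b.1 + 1 ∧ c.2 = b.2 → T c ≤ T b) := by
  rw [boxWeight_lt, NextBox]
  constructor
  · intro h
    constructor <;> rintro ⟨h1, h2⟩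
    · have := h (Or.inl ⟨h1, h2⟩)
      omega
    · have := h (Or.inr ⟨h1, h2⟩)
      omega
  · rintro ⟨h1, h2⟩ (h | h)
    · exact Or.inl (h1 h)
    · have := h2 h
      omega

theorem semistandardOn_iff {lam : Finset (ℕ × ℕ)} (hlam : IsSkewShape lam) {T : ℕ × ℕ → ℕ} :
    SemistandardOn lam T ↔
      ∀ b ∈ lam, ∀ c ∈ lam, NextBox b c → boxWeight T b < boxWeight T c := by
  constructor
  · rintro ⟨hrow, hcol⟩ ⟨i, j⟩ hb ⟨i', j'⟩ hc (⟨h1, h2⟩ | ⟨h1, h2⟩)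
    · simp only at h1 h2
      subst h1 h2
      have := hrow _ _ _ hb hc (Nat.lt_succ_self j)
      rw [boxWeight_lt]
      push_cast
      omega
    · simp only at h1 h2
      subst h1 h2
      exact boxWeight_lt.2 (Or.inl (hcol _ _ _ hb hc (Nat.lt_succ_self i)))
  · intro h
    constructor
    · intro i j j' hb hc hlt
      induction j', hlt using Nat.le_induction with
      | base =>
        have := boxWeight_lt.1 (h _ hb _ hc (Or.inl ⟨rfl, rfl⟩))
        omega
      | succ k hk ih =>
        have hmem : (i, k) ∈ lam := hlam.2 _ hb _ hc _
          (Prod.mk_le_mk.2 ⟨le_rfl, by omega⟩) (Prod.mk_le_mk.2 ⟨le_rfl, by omega⟩)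
        have := boxWeight_lt.1 (h _ hmem _ hc (Or.inl ⟨rfl, rfl⟩))
        have := ih hmem
        omega
    · intro i i' j hb hc hlt
      induction i', hlt using Nat.le_induction with
      | base =>
        have := boxWeight_lt.1 (h _ hb _ hc (Or.inr ⟨rfl, rfl⟩))
        push_cast at this
        omega
      | succ k hk ih =>
        have hmem : (k, j) ∈ lam := hlam.2 _ hb _ hc _
          (Prod.mk_le_mk.2 ⟨by omega, le_rfl⟩) (Prod.mk_le_mk.2 ⟨by omega, le_rfl⟩)
        have := boxWeight_lt.1 (h _ hmem _ hc (Or.inr ⟨rfl, rfl⟩))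
        have := ih hmem
        push_cast at *
        omega

/-- The computation of the coefficients `b_{σ,μ,T′,T″}` in the proof of
Theorem 3.6: the signed count of chains of right-down-closed subsets of `lam`
whose successive differences are reverse row-strict for `T′` is `(-1)^{|lam|}`
if `T′` is semistandard and `0` otherwise. -/
theorem signed_chain_count_eq
    (lam : Finset (ℕ × ℕ)) (hlam : IsSkewShape lam)
    (T : ℕ × ℕ → ℕ) (hT : PosOn lam T) :
    (∑ᶠ ℓ : ℕ, ∑ᶠ I : Fin (ℓ + 1) → Finset (ℕ × ℕ),
        if (I 0 = ∅ ∧ I (Fin.last ℓ) = lam ∧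
            (∀ i : Fin ℓ, I i.castSucc ⊂ I i.succ) ∧
            (∀ i : Fin (ℓ + 1), I i ⊆ lam ∧ RightDownClosed lam (I i)) ∧
            ∀ i : Fin ℓ, ∀ b ∈ I i.succ \ I i.castSucc, ∀ b' ∈ I i.succ \ I i.castSucc,
              (b'.1 = b.1 ∧ b'.2 = b.2 + 1 → T b' < T b) ∧
                (b'.1 = b.1 + 1 ∧ b'.2 = b.2 → T b' ≤ T b)) then
          (-1 : ℤ) ^ ℓ
        else 0) =
      if SemistandardOn lam T then (-1 : ℤ) ^ lam.card else 0 := by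
  set step : Finset (ℕ × ℕ) → Finset (ℕ × ℕ) → Prop := fun J S =>
    (J ⊆ lam ∧ RightDownClosed lam J) ∧ (S ⊆ lam ∧ RightDownClosed lam S) ∧
      ∀ b ∈ S \ J, ∀ c ∈ S \ J, NextBox b c → boxWeight T c < boxWeight T b with hstep
  have key := sum_stepChains_closed (boxWeight T) (E := NextBox) (fun b c h => boxWeight_ne h)
    (lam := lam) (ok := fun J => J ⊆ lam ∧ RightDownClosed lam J) (fun J => Iff.rfl)
    (step := step) (fun J S => Iff.rfl) (Nat.lt_succ_self lam.card)
  rw [finsum_stepChains step lam]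
  · rw [key]
    simp only [← semistandardOn_iff hlam]
  · intro ℓ I
    rw [mem_stepChains]
    simp only [hstep, boxWeight_decreasing_iff]
    constructor
    · rintro ⟨h0, hl, hss, hok, hd⟩
      exact ⟨h0, hl, fun i => ⟨hss i, hok _, hok _, hd i⟩⟩
    · rintro ⟨h0, hl, h⟩
      refine ⟨h0, hl, fun i => (h i).1, fun i => ?_, fun i => (h i).2.2.2⟩
      induction i using Fin.cases with
      | zero => rw [h0]; exact ⟨Finset.empty_subset _, fun b hb => by simp at hb⟩
      | succ i => exact (h i).2.2.1
end

section
/- Let P be a finite poset. Then the sum of (−1)^ℓ, over all increasing sequences ∅ = I₀ ⊊ I₁ ⊊ ⋯ ⊊ I_ℓ = P of order ideals of P such that each difference I_i ∖ I_{i−1} is an antichain of P, equals (−1)^{|P|}. -/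
open scoped Classical

section AntichainIdealChain

variable {P : Type*} [PartialOrder P]

/-- `I` is a strictly increasing sequence of order ideals from `∅` to `J` whose successive
differences are antichains. -/
def IsAntichainIdealChain {ℓ : ℕ} (I : Fin (ℓ + 1) → Finset P) (J : Finset P) : Prop :=
  I 0 = ∅ ∧ I (Fin.last ℓ) = J ∧
    (∀ i : Fin ℓ, I i.castSucc ⊂ I i.succ) ∧
    (∀ i : Fin (ℓ + 1), IsLowerSet (↑(I i) : Set P)) ∧
    ∀ i : Fin ℓ, IsAntichain (· ≤ ·) (↑(I i.succ \ I i.castSucc) : Set P)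

/-- `I` is an order ideal strictly below `J` whose complement in `J` is an antichain. -/
def IsAntichainIdealStep (I J : Finset P) : Prop :=
  I ⊂ J ∧ IsLowerSet (↑I : Set P) ∧ IsAntichain (· ≤ ·) (↑(J \ I) : Set P)

theorem isAntichainIdealChain_zero_iff (I : Fin 1 → Finset P) (J : Finset P) :
    IsAntichainIdealChain (ℓ := 0) I J ↔ I 0 = J ∧ J = ∅ := by
  constructor
  · rintro ⟨h0, h1, -⟩
    have h1 : I 0 = J := h1
    exact ⟨h1, h1 ▸ h0⟩
  · rintro ⟨h1, rfl⟩
    refine ⟨h1, h1, fun i => i.elim0, fun i => ?_, fun i => i.elim0⟩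
    rw [Fin.fin_one_eq_zero i, h1]
    simpa using isLowerSet_empty

theorem forall_snoc_castSucc_succ_iff {α : Type*} (r : α → α → Prop) {n : ℕ}
    (f : Fin (n + 1) → α) (a : α) :
    (∀ i : Fin (n + 1), r (Fin.snoc (α := fun _ => α) f a i.castSucc)
      (Fin.snoc (α := fun _ => α) f a i.succ)) ↔
      (∀ i : Fin n, r (f i.castSucc) (f i.succ)) ∧ r (f (Fin.last n)) a := by
  rw [Fin.forall_fin_succ']
  simp only [Fin.snoc_last, Fin.snoc_castSucc, Fin.succ_last, Fin.succ_castSucc]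

theorem isAntichainIdealChain_snoc_iff {ℓ : ℕ} (I : Fin (ℓ + 1) → Finset P) (K J : Finset P)
    (hJ : IsLowerSet (↑J : Set P)) :
    IsAntichainIdealChain (Fin.snoc (α := fun _ => Finset P) I K) J ↔
      K = J ∧ IsAntichainIdealChain I (I (Fin.last ℓ)) ∧
        IsAntichainIdealStep (I (Fin.last ℓ)) J := by
  unfold IsAntichainIdealChain IsAntichainIdealStep
  have h0 : Fin.snoc (α := fun _ => Finset P) I K 0 = I 0 := by
    rw [← Fin.castSucc_zero, Fin.snoc_castSucc (α := fun _ => Finset P)]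
  have hl : ∀ p : Finset P → Prop, (∀ i, p (Fin.snoc (α := fun _ => Finset P) I K i)) ↔
      (∀ i, p (I i)) ∧ p K := fun p => by
    rw [Fin.forall_fin_succ']
    simp only [Fin.snoc_castSucc, Fin.snoc_last]
  have hlt := forall_snoc_castSucc_succ_iff (fun A B : Finset P => A ⊂ B) I K
  have hanti := forall_snoc_castSucc_succ_iff
    (fun A B : Finset P => IsAntichain (· ≤ ·) (↑(B \ A) : Set P)) I K
  rw [h0, hl (fun A => IsLowerSet (↑A : Set P)), hlt, hanti, Fin.snoc_last]
  constructor
  · rintro ⟨h0, rfl, ⟨hs, hl⟩, ⟨hI, -⟩, ha, hb⟩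
    exact ⟨rfl, ⟨h0, rfl, hs, hI, ha⟩, hl, hI _, hb⟩
  · rintro ⟨rfl, ⟨h0, -, hs, hI, ha⟩, hl, -, hb⟩
    exact ⟨h0, rfl, ⟨hs, hl⟩, ⟨hI, hJ⟩, ha, hb⟩

/-- Removing a set from an order ideal leaves an order ideal with antichain complement exactly
when the removed set consists of maximal elements. -/
theorem isAntichainIdealStep_iff {I J : Finset P} (hJ : IsLowerSet (↑J : Set P)) :
    IsAntichainIdealStep I J ↔
      I ⊂ J ∧ J \ I ⊆ J.filter (fun x => Maximal (· ∈ J) x) := by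
  refine and_congr_right fun hIJ => ⟨?_, ?_⟩
  · rintro ⟨hI, ha⟩ x hx
    have hx' := Finset.mem_sdiff.1 hx
    refine Finset.mem_filter.2 ⟨hx'.1, hx'.1, fun y hy hxy => ?_⟩
    have hyI : y ∉ I := fun h => hx'.2 (hI hxy h)
    have := ha.eq (a := x) (b := y) (by simpa using hx') (by simp [hy, hyI]) hxy
    exact this.ge
  · intro h
    refine ⟨fun a b hba ha => ?_, fun x hx y hy hne hxy => ?_⟩
    · by_contra hb
      have hbJ : b ∈ J := hJ hba (hIJ.1 ha)
      have hm := (Finset.mem_filter.1 (h (Finset.mem_sdiff.2 ⟨hbJ, hb⟩))).2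
      have : a = b := le_antisymm (hm.2 (hIJ.1 ha) hba) hba
      exact hb (this ▸ ha)
    · have hm := (Finset.mem_filter.1 (h hx)).2
      exact hne (le_antisymm hxy (hm.2 (Finset.mem_sdiff.1 hy).1 hxy))

variable [Fintype P]

theorem sum_isAntichainIdealStep_neg_one_pow_card {J : Finset P}
    (hJ : IsLowerSet (↑J : Set P)) (hne : J.Nonempty) :
    ∑ I with IsAntichainIdealStep I J, (-1 : ℤ) ^ I.card = -(-1) ^ J.card := by
  set M := J.filter (fun x => Maximal (· ∈ J) x) with hM
  have hMJ : M ⊆ J := Finset.filter_subset _ _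
  have hMne : M.Nonempty := by
    obtain ⟨m, hm⟩ := J.exists_maximal hne
    exact ⟨m, Finset.mem_filter.2 ⟨hm.1, hm⟩⟩
  have key : ∑ I with IsAntichainIdealStep I J, (-1 : ℤ) ^ I.card =
      ∑ S ∈ M.powerset.erase ∅, (-1 : ℤ) ^ J.card * (-1) ^ S.card := by
    refine Finset.sum_bij' (fun I _ => J \ I) (fun S _ => J \ S) ?_ ?_ ?_ ?_ ?_
    · intro I hI
      have h := (isAntichainIdealStep_iff hJ).1 (Finset.mem_filter.1 hI).2
      refine Finset.mem_erase.2 ⟨?_, Finset.mem_powerset.2 h.2⟩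
      exact fun h' => h.1.2 (Finset.sdiff_eq_empty_iff_subset.1 h')
    · intro S hS
      obtain ⟨hS0, hS⟩ := Finset.mem_erase.1 hS
      have hS := Finset.mem_powerset.1 hS
      refine Finset.mem_filter.2 ⟨Finset.mem_univ _, (isAntichainIdealStep_iff hJ).2 ⟨?_, ?_⟩⟩
      · exact Finset.sdiff_ssubset (hS.trans hMJ) (Finset.nonempty_iff_ne_empty.2 hS0)
      · rwa [Finset.sdiff_sdiff_eq_self (hS.trans hMJ)]
    · intro I hI
      exact Finset.sdiff_sdiff_eq_self (Finset.mem_filter.1 hI).2.1.1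
    · intro S hS
      exact Finset.sdiff_sdiff_eq_self
        ((Finset.mem_powerset.1 (Finset.mem_erase.1 hS).2).trans hMJ)
    · intro I hI
      have h := Finset.card_sdiff_add_card_eq_card (Finset.mem_filter.1 hI).2.1.1
      rw [← h, pow_add, mul_right_comm, ← mul_pow]
      simp
  rw [key, ← Finset.mul_sum, Finset.sum_erase_eq_sub (Finset.empty_mem_powerset M),
    Finset.sum_powerset_neg_one_pow_card_of_nonempty hMne]
  simp

/-- The contribution of the chains of length `ℓ` ending at `J` to the signed count. -/
noncomputable def signedChainCount (ℓ : ℕ) (J : Finset P) : ℤ :=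
  ∑ I : Fin (ℓ + 1) → Finset P, if IsAntichainIdealChain I J then (-1) ^ ℓ else 0

theorem signedChainCount_zero (J : Finset P) :
    signedChainCount 0 J = if J = ∅ then 1 else 0 := by
  unfold signedChainCount
  rw [← (Equiv.funUnique (Fin 1) (Finset P)).symm.sum_comp]
  simp [isAntichainIdealChain_zero_iff, ite_and]

theorem signedChainCount_succ (ℓ : ℕ) {J : Finset P} (hJ : IsLowerSet (↑J : Set P)) :
    signedChainCount (ℓ + 1) J =
      -∑ K with IsAntichainIdealStep K J, signedChainCount ℓ K := by
  unfold signedChainCount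
  rw [← (Fin.snocEquiv (fun _ : Fin (ℓ + 2) => Finset P)).sum_comp, Fintype.sum_prod_type,
    Finset.sum_comm, Finset.sum_comm (s := Finset.filter _ _), ← Finset.sum_neg_distrib]
  refine Finset.sum_congr rfl fun I _ => ?_
  have hK : ∀ K, IsAntichainIdealChain I K ↔
      K = I (Fin.last ℓ) ∧ IsAntichainIdealChain I (I (Fin.last ℓ)) := fun K =>
    ⟨fun h => ⟨h.2.1.symm, h.2.1 ▸ h⟩, fun h => h.1 ▸ h.2⟩
  have hsnoc : ∀ K, IsAntichainIdealChain
      (Fin.snocEquiv (fun _ : Fin (ℓ + 2) => Finset P) (K, I)) J ↔ _ := fun K =>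
    isAntichainIdealChain_snoc_iff I K J hJ
  simp only [hsnoc]
  generalize IsAntichainIdealChain I (I (Fin.last ℓ)) = c at hK ⊢
  simp only [hK, ite_and, Finset.sum_ite_eq', Finset.mem_univ, Finset.mem_filter, true_and, if_true]
  split_ifs <;> simp [pow_succ]

theorem signedChainCount_eq_zero {ℓ : ℕ} {J : Finset P} (hJ : IsLowerSet (↑J : Set P))
    (h : J.card < ℓ) : signedChainCount ℓ J = 0 := by
  induction ℓ generalizing J with
  | zero => omega
  | succ ℓ ih =>
    rw [signedChainCount_succ ℓ hJ, Finset.sum_eq_zero, neg_zero]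
    intro K hK
    obtain ⟨hKJ, hKl, -⟩ := (Finset.mem_filter.1 hK).2
    have := Finset.card_lt_card hKJ
    exact ih hKl (by omega)

theorem sum_range_signedChainCount {N : ℕ} {J : Finset P} (hJ : IsLowerSet (↑J : Set P))
    (h : J.card ≤ N) :
    ∑ ℓ ∈ Finset.range (N + 1), signedChainCount ℓ J = (-1) ^ J.card := by
  induction N generalizing J with
  | zero =>
    obtain rfl : J = ∅ := Finset.card_eq_zero.1 (by omega)
    simp [signedChainCount_zero]
  | succ N ih =>
    have hstep : ∑ ℓ ∈ Finset.range (N + 1), signedChainCount (ℓ + 1) J =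
        -∑ K with IsAntichainIdealStep K J, (-1 : ℤ) ^ K.card := by
      simp_rw [signedChainCount_succ _ hJ]
      rw [Finset.sum_neg_distrib, Finset.sum_comm]
      refine congrArg Neg.neg (Finset.sum_congr rfl fun K hK => ?_)
      obtain ⟨hKJ, hKl, -⟩ := (Finset.mem_filter.1 hK).2
      have := Finset.card_lt_card hKJ
      exact ih hKl (by omega)
    rw [Finset.sum_range_succ', hstep, signedChainCount_zero]
    rcases J.eq_empty_or_nonempty with rfl | hne
    · simp [IsAntichainIdealStep]
    · rw [sum_isAntichainIdealStep_neg_one_pow_card hJ hne, if_neg hne.ne_empty]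
      simp

end AntichainIdealChain

/-- The case `G = ∅` of Lemma 3.17 (see Example 3.18): in a finite poset `P`, the
sum of `(-1)^ℓ` over all chains `∅ = I₀ ⊊ I₁ ⊊ ⋯ ⊊ I_ℓ = P` of order ideals whose
successive differences are antichains equals `(-1)^{|P|}`. -/
theorem antichain_ideal_chain_signed_count (P : Type*) [Fintype P] [PartialOrder P] :
    (∑ᶠ ℓ : ℕ, ∑ᶠ I : Fin (ℓ + 1) → Finset P,
        if (I 0 = ∅ ∧ I (Fin.last ℓ) = Finset.univ ∧
            (∀ i : Fin ℓ, I i.castSucc ⊂ I i.succ) ∧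
            (∀ i : Fin (ℓ + 1), IsLowerSet (↑(I i) : Set P)) ∧
            ∀ i : Fin ℓ, IsAntichain (· ≤ ·) (↑(I i.succ \ I i.castSucc) : Set P)) then
          (-1 : ℤ) ^ ℓ
        else 0) = (-1 : ℤ) ^ Fintype.card P := by
  have huniv : IsLowerSet (↑(Finset.univ : Finset P) : Set P) := by
    simpa using isLowerSet_univ
  rw [← Finset.card_univ, ← sum_range_signedChainCount huniv le_rfl]
  trans ∑ᶠ ℓ : ℕ, signedChainCount ℓ (Finset.univ : Finset P)
  · refine finsum_congr fun ℓ => ?_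
    rw [finsum_eq_sum_of_fintype, signedChainCount]
    refine Finset.sum_congr rfl fun I _ => ?_
    unfold IsAntichainIdealChain
    congr
  · refine finsum_eq_sum_of_support_subset _ fun ℓ hℓ => ?_
    by_contra hlt
    exact hℓ (signedChainCount_eq_zero huniv (by simpa using hlt))
end

section
/- Let σ be a connected skew Young diagram and let μ ⊇ σ be a skew Young diagram (so every box of μ lies in a column containing a box of σ). Then every box (i, j) ∈ μ ∖ σ satisfies exactly one of: i < i′ for every box (i′, j) ∈ σ in the same column j, or i > i′ for every box (i′, j) ∈ σ in the same column j. Consequently μ ∖ σ is the disjoint union of A(μ/σ) (the boxes above σ) and B(μ/σ) (the boxes below σ), and both A(μ/σ) and B(μ/σ) are themselves skew Young diagrams. -/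
open scoped Classical

/-- A box in a column of a skew shape `σ` that avoids `σ` lies above or below `σ`. -/
theorem IsSkewShape.above_or_below {σ : Finset (ℕ × ℕ)} (hσ : IsSkewShape σ) {b : ℕ × ℕ}
    (hb : b ∉ σ) :
    (∀ b' ∈ σ, b'.2 = b.2 → b.1 < b'.1) ∨ (∀ b' ∈ σ, b'.2 = b.2 → b'.1 < b.1) := by
  by_contra! h
  obtain ⟨⟨s, hs, hsb, hs'⟩, t, ht, htb, ht'⟩ := h
  exact hb (hσ.2 s hs t ht b ⟨hs', hsb.le⟩ ⟨ht', htb.ge⟩)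

theorem isSkewShape_shapeAbove {σ μ : Finset (ℕ × ℕ)} (hσ : IsSkewShape σ)
    (hμ : IsSkewShape μ) (hext : Extends σ μ) : IsSkewShape (shapeAbove σ μ) := by
  simp only [IsSkewShape, shapeAbove, Finset.mem_filter, Finset.mem_sdiff]
  refine ⟨fun b hb => hμ.1 b hb.1.1, ?_⟩
  rintro b ⟨⟨hbμ, -⟩, -⟩ c ⟨⟨hcμ, hcσ⟩, hc⟩ x hbx hxc
  have habove : ∀ s ∈ σ, s.2 = x.2 → x.1 < s.1 := by
    intro s hs hsx
    by_contra! hle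
    obtain ⟨t, ht, htc⟩ := hext.2 c hcμ
    exact hcσ (hσ.2 s hs t ht c ⟨hle.trans hxc.1, hsx.trans_le hxc.2⟩
      ⟨(hc t ht htc).le, htc.ge⟩)
  exact ⟨⟨hμ.2 b hbμ c hcμ x hbx hxc, fun hx => (habove x hx rfl).false⟩, habove⟩

theorem isSkewShape_shapeBelow {σ μ : Finset (ℕ × ℕ)} (hσ : IsSkewShape σ)
    (hμ : IsSkewShape μ) (hext : Extends σ μ) : IsSkewShape (shapeBelow σ μ) := by
  simp only [IsSkewShape, shapeBelow, Finset.mem_filter, Finset.mem_sdiff]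
  refine ⟨fun b hb => hμ.1 b hb.1.1, ?_⟩
  rintro b ⟨⟨hbμ, hbσ⟩, hb⟩ c ⟨⟨hcμ, -⟩, -⟩ x hbx hxc
  have hbelow : ∀ s ∈ σ, s.2 = x.2 → s.1 < x.1 := by
    intro s hs hsx
    by_contra! hle
    obtain ⟨t, ht, htb⟩ := hext.2 b hbμ
    exact hbσ (hσ.2 t ht s hs b ⟨(hb t ht htb).le, htb.le⟩
      ⟨hbx.1.trans hle, hbx.2.trans hsx.ge⟩)
  exact ⟨⟨hμ.2 b hbμ c hcμ x hbx hxc, fun hx => (hbelow x hx rfl).false⟩, hbelow⟩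

/-- For a connected skew shape `σ` and a skew shape `μ ⊇ σ`, every box of `μ \ σ`
lies either strictly above or strictly below the boxes of `σ` in its column
(exactly one of the two), so `μ \ σ = A(μ/σ) ⊔ B(μ/σ)`, and both `A(μ/σ)` and
`B(μ/σ)` are skew shapes. -/
theorem above_below_decomposition
    (σ μ : Finset (ℕ × ℕ))
    (hσ : IsSkewShape σ) (hconn : IsConnectedShape σ)
    (hμ : IsSkewShape μ) (hext : Extends σ μ) :
    (∀ b ∈ μ \ σ,
        Xor' (∀ b' ∈ σ, b'.2 = b.2 → b.1 < b'.1) (∀ b' ∈ σ, b'.2 = b.2 → b'.1 < b.1)) ∧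
      μ \ σ = shapeAbove σ μ ∪ shapeBelow σ μ ∧
      Disjoint (shapeAbove σ μ) (shapeBelow σ μ) ∧
      IsSkewShape (shapeAbove σ μ) ∧ IsSkewShape (shapeBelow σ μ) := by
  have hnot : ∀ b ∈ μ, (∀ b' ∈ σ, b'.2 = b.2 → b.1 < b'.1) →
      ¬ ∀ b' ∈ σ, b'.2 = b.2 → b'.1 < b.1 := by
    intro b hb ha hb'
    obtain ⟨t, ht, htb⟩ := hext.2 b hb
    exact (ha t ht htb).asymm (hb' t ht htb)
  refine ⟨fun b hb => ?_, ?_, ?_, isSkewShape_shapeAbove hσ hμ hext,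
    isSkewShape_shapeBelow hσ hμ hext⟩
  · rw [Finset.mem_sdiff] at hb
    rcases hσ.above_or_below hb.2 with h | h
    · exact Or.inl ⟨h, hnot b hb.1 h⟩
    · exact Or.inr ⟨h, fun h' => hnot b hb.1 h' h⟩
  · rw [shapeAbove, shapeBelow, ← Finset.filter_or, eq_comm, Finset.filter_eq_self]
    exact fun b hb => hσ.above_or_below (Finset.mem_sdiff.1 hb).2
  · exact Finset.disjoint_filter.2 fun b hb => hnot b (Finset.mem_sdiff.1 hb).1
end
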